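/- Let $1 < p < \infty$ and $0 < s < 1$. For all $f \in W^{s,p}(\mathcal{O}_1)$ on the first octant $\mathcal{O}_1 = (0,\infty)^3$, the full Gagliardo seminorm is comparable to the truncated directional seminorms: $\|f\|_{W^{s,p}(\mathcal{O}_1)}^p \approx_{s,p} \|f\|_{L^p(\mathcal{O}_1)}^p + \sum_{i=1}^3 \int_0^1 \int_{\mathcal{O}_1} \frac{|f(\mathbf{x}+t\mathbf{e}_i) - f(\mathbf{x})|^p}{t^{1+sp}}\,d\mathbf{x}\,dt$. -/

import Mathlib

open MeasureTheory Set
open scoped ENNReal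

/-- The first octant `(0,∞)³` (as a subset of `ℝ × ℝ × ℝ`). -/
def oct : Set (ℝ × ℝ × ℝ) := {w | 0 < w.1 ∧ 0 < w.2.1 ∧ 0 < w.2.2}

/-- The full `W^{s,p}` norm (to the `p`-th power) on the first octant:
`L^p` norm plus the Gagliardo seminorm with kernel `|x - y|^{-(sp+3)}`
(Euclidean distance). -/
noncomputable def fullNorm (p s : ℝ) (f : ℝ × ℝ × ℝ → ℝ) : ℝ≥0∞ :=
  (∫⁻ x in oct, ENNReal.ofReal (|f x| ^ p)) +
    ∫⁻ x in oct, ∫⁻ y in oct,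
      ENNReal.ofReal (|f x - f y| ^ p /
        (((x.1 - y.1) ^ 2 + (x.2.1 - y.2.1) ^ 2 + (x.2.2 - y.2.2) ^ 2) ^ ((s * p + 3) / 2)))

/-- The truncated directional norm (to the `p`-th power): `L^p` norm plus the
three directional difference-quotient integrals over translations `t ∈ (0,1)`. -/
noncomputable def truncNorm (p s : ℝ) (f : ℝ × ℝ × ℝ → ℝ) : ℝ≥0∞ :=
  (∫⁻ x in oct, ENNReal.ofReal (|f x| ^ p)) +
    ((∫⁻ t in Ioo (0 : ℝ) 1, ∫⁻ x in oct,
        ENNReal.ofReal (|f (x.1 + t, x.2.1, x.2.2) - f x| ^ p / t ^ (1 + s * p))) +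
      (∫⁻ t in Ioo (0 : ℝ) 1, ∫⁻ x in oct,
        ENNReal.ofReal (|f (x.1, x.2.1 + t, x.2.2) - f x| ^ p / t ^ (1 + s * p))) +
      ∫⁻ t in Ioo (0 : ℝ) 1, ∫⁻ x in oct,
        ENNReal.ofReal (|f (x.1, x.2.1, x.2.2 + t) - f x| ^ p / t ^ (1 + s * p)))


noncomputable def gp (p a b : ℝ) : ℝ≥0∞ := ENNReal.ofReal (|a - b| ^ p)

lemma gp_eq (p : ℝ) (hp : 0 ≤ p) (a b : ℝ) : gp p a b = ENNReal.ofReal |a - b| ^ p := by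
  rw [gp, ENNReal.ofReal_rpow_of_nonneg (abs_nonneg _) hp]

lemma gp_comm (p a b : ℝ) : gp p a b = gp p b a := by
  rw [gp, gp, abs_sub_comm]

lemma gp_self (p : ℝ) (hp : 1 < p) (a : ℝ) : gp p a a = 0 := by
  simp [gp, Real.zero_rpow (by linarith : p ≠ 0)]

lemma gp_tri (p : ℝ) (hp : 1 < p) (a b c : ℝ) :
    gp p a c ≤ 2 ^ (p - 1) * (gp p a b + gp p b c) := by
  rw [gp_eq p (by linarith), gp_eq p (by linarith), gp_eq p (by linarith)]
  refine le_trans ?_ (ENNReal.rpow_add_le_mul_rpow_add_rpow _ _ hp.le)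
  refine ENNReal.rpow_le_rpow ?_ (by linarith)
  rw [← ENNReal.ofReal_add (abs_nonneg _) (abs_nonneg _)]
  exact ENNReal.ofReal_le_ofReal (abs_sub_le a b c)

@[fun_prop]
lemma gp_meas {α : Type*} [MeasurableSpace α] (p : ℝ) {u v : α → ℝ} (hu : Measurable u)
    (hv : Measurable v) : Measurable (fun z => gp p (u z) (v z)) := by
  have : Measurable (fun z => |u z - v z|) := by
    have := (hu.sub hv).norm
    simpa [Real.norm_eq_abs] using this
  unfold gp
  exact (this.pow_const p).ennreal_ofReal

lemma two_ne_top (p : ℝ) (hp : 1 < p) : (2 : ℝ≥0∞) ^ (p - 1) ≠ ⊤ :=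
  ENNReal.rpow_ne_top_of_nonneg (by linarith) (by simp)

/-- squared distance -/
def dd (x y : ℝ × ℝ × ℝ) : ℝ := (x.1 - y.1) ^ 2 + (x.2.1 - y.2.1) ^ 2 + (x.2.2 - y.2.2) ^ 2

@[fun_prop]
lemma dd_meas {α : Type*} [MeasurableSpace α] {u v : α → ℝ × ℝ × ℝ} (hu : Measurable u)
    (hv : Measurable v) : Measurable (fun z => dd (u z) (v z)) := by
  unfold dd; fun_prop

lemma dd_nonneg (x y : ℝ × ℝ × ℝ) : 0 ≤ dd x y := by unfold dd; positivity

lemma dd_comm (x y : ℝ × ℝ × ℝ) : dd x y = dd y x := by unfold dd; ring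

lemma dd_eq_zero {x y : ℝ × ℝ × ℝ} (h : dd x y = 0) : x = y := by
  unfold dd at h
  have h1 : x.1 - y.1 = 0 := by
    apply pow_eq_zero_iff (two_ne_zero) |>.1
    nlinarith [sq_nonneg (x.1 - y.1), sq_nonneg (x.2.1 - y.2.1), sq_nonneg (x.2.2 - y.2.2)]
  have h2 : x.2.1 - y.2.1 = 0 := by
    apply pow_eq_zero_iff (two_ne_zero) |>.1
    nlinarith [sq_nonneg (x.1 - y.1), sq_nonneg (x.2.1 - y.2.1), sq_nonneg (x.2.2 - y.2.2)]
  have h3 : x.2.2 - y.2.2 = 0 := by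
    apply pow_eq_zero_iff (two_ne_zero) |>.1
    nlinarith [sq_nonneg (x.1 - y.1), sq_nonneg (x.2.1 - y.2.1), sq_nonneg (x.2.2 - y.2.2)]
  ext <;> linarith

/-- power kernel -/
noncomputable def pk (m t : ℝ) : ℝ≥0∞ := ENNReal.ofReal ((t ^ m)⁻¹)

@[fun_prop]
lemma pk_meas {α : Type*} [MeasurableSpace α] (m : ℝ) {u : α → ℝ} (hu : Measurable u) :
    Measurable (fun z => pk m (u z)) := by
  unfold pk
  exact (hu.pow_const m).inv.ennreal_ofReal

lemma ofReal_div' (a b p m : ℝ) (h : ℝ) : ENNReal.ofReal (|a - b| ^ p / h ^ m) = gp p a b * pk m h := by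
  rw [gp, pk, ← ENNReal.ofReal_mul (by positivity), div_eq_mul_inv]

lemma tail_int (m r : ℝ) (hm : 1 < m) (hr : 0 < r) :
    ∫⁻ t in Ioi r, pk m t = ENNReal.ofReal (r ^ (1 - m) / (m - 1)) := by
  have h1 := integral_Ioi_rpow_of_lt (a := -m) (by linarith) hr
  have h2 := integrableOn_Ioi_rpow_of_lt (a := -m) (by linarith) hr
  have h3 := ofReal_integral_eq_lintegral_ofReal h2 (by
    filter_upwards [ae_restrict_mem measurableSet_Ioi] with t ht
    have : 0 < t := lt_trans hr ht
    simp only [Pi.zero_apply]; positivity)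
  rw [h1] at h3
  rw [show r ^ (1 - m) / (m - 1) = -r ^ (-m + 1) / (-m + 1) by
    rw [show 1 - m = -m + 1 by ring, show m - 1 = -(-m + 1) by ring, div_neg, neg_div], h3]
  refine setLIntegral_congr_fun measurableSet_Ioi fun t ht => ?_
  have : 0 < t := lt_trans hr ht
  simp only [pk]; rw [Real.rpow_neg this.le]

lemma oct_eq : oct = Ioi (0:ℝ) ×ˢ (Ioi (0:ℝ) ×ˢ Ioi (0:ℝ)) := by
  ext x; simp [oct]

lemma oct_meas : MeasurableSet oct := by
  rw [oct_eq]; measurability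

/-- Gagliardo seminorm -/
noncomputable def gag (p s : ℝ) (f : ℝ × ℝ × ℝ → ℝ) : ℝ≥0∞ :=
  ∫⁻ x in oct, ∫⁻ y in oct, gp p (f x) (f y) * pk ((s * p + 3) / 2) (dd x y)

noncomputable def loc (p : ℝ) (f : ℝ × ℝ × ℝ → ℝ) (t : ℝ) (z : ℝ × ℝ × ℝ) : ℝ≥0∞ :=
  ∫⁻ y in oct, gp p (f z) (f y) * (if dd z y < 3 * t ^ 2 then 1 else 0)

@[fun_prop]
lemma ind_meas {α : Type*} [MeasurableSpace α] {u v : α → ℝ × ℝ × ℝ} {w : α → ℝ}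
    (hu : Measurable u)
    (hv : Measurable v) (hw : Measurable w) :
    Measurable (fun z => (if dd (u z) (v z) < 3 * (w z) ^ 2 then 1 else 0 : ℝ≥0∞)) := by
  refine Measurable.ite ?_ measurable_const measurable_const
  exact measurableSet_lt (by fun_prop) (by fun_prop)

lemma step_avg (p : ℝ) (hp : 1 < p) (f : ℝ × ℝ × ℝ → ℝ) (hf : Measurable f) (e1 e2 e3 : ℝ)
    (h1 : 0 ≤ e1) (h1' : e1 ≤ 1) (h2 : 0 ≤ e2) (h2' : e2 ≤ 1) (h3 : 0 ≤ e3) (h3' : e3 ≤ 1)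
    (t : ℝ) (ht : 0 < t) (x : ℝ × ℝ × ℝ) (hx : x ∈ oct) :
    gp p (f (x + (t * e1, t * e2, t * e3))) (f x) * ENNReal.ofReal (t ^ 3) ≤
      2 ^ (p - 1) * (loc p f t (x + (t * e1, t * e2, t * e3)) + loc p f t x) := by
  set z := x + (t * e1, t * e2, t * e3) with hz
  set B : Set (ℝ × ℝ × ℝ) :=
    Ioo x.1 (x.1 + t) ×ˢ (Ioo x.2.1 (x.2.1 + t) ×ˢ Ioo x.2.2 (x.2.2 + t)) with hB
  have hBm : MeasurableSet B := by measurability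
  have hvol : volume B = ENNReal.ofReal (t ^ 3) := by
    rw [hB, Measure.volume_eq_prod, Measure.prod_prod, Measure.volume_eq_prod, Measure.prod_prod]
    simp only [Real.volume_Ioo, add_sub_cancel_left]
    rw [← ENNReal.ofReal_mul ht.le, ← ENNReal.ofReal_mul ht.le]
    congr 1; ring
  have hsub : B ⊆ oct := by
    intro y hy
    simp only [hB, mem_prod, mem_Ioo] at hy
    obtain ⟨a, b, c⟩ := hx
    exact ⟨by linarith [hy.1.1], by linarith [hy.2.1.1], by linarith [hy.2.2.1]⟩
  have sqlt : ∀ u : ℝ, -t < u → u < t → u ^ 2 < t ^ 2 := fun u a b => by nlinarith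
  calc gp p (f z) (f x) * ENNReal.ofReal (t ^ 3) = ∫⁻ y in B, gp p (f z) (f x) := by
        rw [setLIntegral_const, hvol]
    _ ≤ ∫⁻ y in B, 2 ^ (p - 1) * (gp p (f z) (f y) * (if dd z y < 3 * t ^ 2 then 1 else 0)
          + gp p (f x) (f y) * (if dd x y < 3 * t ^ 2 then 1 else 0)) := by
        refine setLIntegral_mono' hBm fun y hy => ?_
        simp only [hB, mem_prod, mem_Ioo] at hy
        obtain ⟨⟨a1, a2⟩, ⟨a3, a4⟩, a5, a6⟩ := hy
        have i1 : dd x y < 3 * t ^ 2 := by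
          have := sqlt (x.1 - y.1) (by linarith) (by linarith)
          have := sqlt (x.2.1 - y.2.1) (by linarith) (by linarith)
          have := sqlt (x.2.2 - y.2.2) (by linarith) (by linarith)
          unfold dd; linarith
        have k1 : 0 ≤ t * e1 ∧ t * e1 ≤ t := ⟨by positivity, by nlinarith⟩
        have k2 : 0 ≤ t * e2 ∧ t * e2 ≤ t := ⟨by positivity, by nlinarith⟩
        have k3 : 0 ≤ t * e3 ∧ t * e3 ≤ t := ⟨by positivity, by nlinarith⟩
        have i2 : dd z y < 3 * t ^ 2 := by
          have := sqlt (x.1 + t * e1 - y.1) (by linarith) (by linarith)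
          have := sqlt (x.2.1 + t * e2 - y.2.1) (by linarith) (by linarith)
          have := sqlt (x.2.2 + t * e3 - y.2.2) (by linarith) (by linarith)
          simp only [dd, hz, Prod.fst_add, Prod.snd_add]; linarith
        rw [if_pos i1, if_pos i2, mul_one, mul_one, gp_comm p (f x) (f y)]
        exact gp_tri p hp _ _ _
    _ ≤ ∫⁻ y in oct, 2 ^ (p - 1) * (gp p (f z) (f y) * (if dd z y < 3 * t ^ 2 then 1 else 0)
          + gp p (f x) (f y) * (if dd x y < 3 * t ^ 2 then 1 else 0)) :=
        lintegral_mono_set hsub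
    _ = _ := by
        rw [lintegral_const_mul _ (by fun_prop), lintegral_add_left (by fun_prop)]
        rfl

lemma shift_oct (G : ℝ × ℝ × ℝ → ℝ≥0∞) (v : ℝ × ℝ × ℝ) (h1 : 0 ≤ v.1) (h2 : 0 ≤ v.2.1)
    (h3 : 0 ≤ v.2.2) : ∫⁻ x in oct, G (x + v) ≤ ∫⁻ x in oct, G x := by
  have i1 : (volume : Measure (ℝ × ℝ)).IsAddHaarMeasure := by
    rw [Measure.volume_eq_prod]; infer_instance
  have i2 : (volume : Measure (ℝ × ℝ × ℝ)).IsAddHaarMeasure := by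
    rw [Measure.volume_eq_prod]; infer_instance
  rw [← lintegral_indicator oct_meas, ← lintegral_indicator oct_meas,
    ← lintegral_add_right_eq_self (oct.indicator G) v]
  refine lintegral_mono fun x => ?_
  by_cases hx : x ∈ oct
  · have : x + v ∈ oct := by
      obtain ⟨a, b, c⟩ := hx
      refine ⟨?_, ?_, ?_⟩ <;> simp <;> linarith
    simp [hx, this]
  · simp [hx]

@[fun_prop]
lemma loc_meas (p : ℝ) (f : ℝ × ℝ × ℝ → ℝ) (hf : Measurable f) :
    Measurable (fun z : ℝ × (ℝ × ℝ × ℝ) => loc p f z.1 z.2) := by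
  unfold loc
  fun_prop

lemma loc_meas' (p : ℝ) (f : ℝ × ℝ × ℝ → ℝ) (hf : Measurable f) (t : ℝ) :
    Measurable (fun z : (ℝ × ℝ × ℝ) => loc p f t z) := by
  unfold loc
  fun_prop

lemma inner_t (p s : ℝ) (hp : 1 < p) (hs0 : 0 < s) (f : ℝ × ℝ × ℝ → ℝ) (x y : ℝ × ℝ × ℝ) :
    ∫⁻ t in Ioi (0:ℝ), gp p (f x) (f y) * (if dd x y < 3 * t ^ 2 then 1 else 0) * pk (4 + s * p) t
      ≤ ENNReal.ofReal (3 ^ ((s * p + 3) / 2) / (3 + s * p)) *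
        (gp p (f x) (f y) * pk ((s * p + 3) / 2) (dd x y)) := by
  have hsp : 0 < s * p := by positivity
  rcases (dd_nonneg x y).eq_or_lt with h | h
  · have := dd_eq_zero h.symm
    subst this
    simp [gp_self p hp]
  set r := Real.sqrt (dd x y / 3) with hr
  have hr0 : 0 < r := Real.sqrt_pos.2 (by positivity)
  have hr2 : r ^ 2 = dd x y / 3 := Real.sq_sqrt (by positivity)
  have : ∀ t ∈ Ioi (0:ℝ), gp p (f x) (f y) * (if dd x y < 3 * t ^ 2 then 1 else 0) * pk (4 + s * p) t
      = gp p (f x) (f y) * (Ioi r).indicator (fun t => pk (4 + s * p) t) t := by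
    intro t ht
    have ht : 0 < t := ht
    by_cases hrt : r < t
    · have : dd x y < 3 * t ^ 2 := by nlinarith
      rw [if_pos this, indicator_of_mem (show t ∈ Ioi r from hrt)]; ring
    · have : ¬ dd x y < 3 * t ^ 2 := by
        push Not at hrt ⊢
        nlinarith
      rw [if_neg this, indicator_of_notMem (show t ∉ Ioi r from hrt)]; ring
  rw [setLIntegral_congr_fun measurableSet_Ioi this, lintegral_const_mul _
    ((by fun_prop : Measurable (fun t => pk (4 + s * p) t)).indicator measurableSet_Ioi),
    lintegral_indicator measurableSet_Ioi, Measure.restrict_restrict measurableSet_Ioi,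
    inter_eq_left.2 (Ioi_subset_Ioi hr0.le), tail_int _ _ (by linarith) hr0,
    mul_left_comm]
  gcongr
  rw [pk, ← ENNReal.ofReal_mul (by positivity)]
  apply ENNReal.ofReal_le_ofReal
  apply le_of_eq
  have : r ^ (1 - (4 + s * p)) = 3 ^ ((s * p + 3) / 2) * (dd x y ^ ((s * p + 3) / 2))⁻¹ := by
    rw [hr, Real.sqrt_eq_rpow, ← Real.rpow_mul (by positivity),
      show 1 / 2 * (1 - (4 + s * p)) = -((s * p + 3) / 2) by ring, Real.rpow_neg (by positivity),
      Real.div_rpow h.le (by norm_num), inv_div]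
    rfl
  rw [this, show 4 + s * p - 1 = 3 + s * p by ring]
  ring

lemma dir2 (p s : ℝ) (hp : 1 < p) (hs0 : 0 < s) :
    ∃ C : ℝ≥0∞, C ≠ ⊤ ∧ ∀ f : ℝ × ℝ × ℝ → ℝ, Measurable f → ∀ e1 e2 e3 : ℝ,
      0 ≤ e1 → e1 ≤ 1 → 0 ≤ e2 → e2 ≤ 1 → 0 ≤ e3 → e3 ≤ 1 →
      ∫⁻ t in Ioo (0:ℝ) 1, ∫⁻ x in oct,
        gp p (f (x + (t * e1, t * e2, t * e3))) (f x) * pk (1 + s * p) t ≤ C * gag p s f := by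
  refine ⟨2 ^ (p - 1) * 2 * ENNReal.ofReal (3 ^ ((s * p + 3) / 2) / (3 + s * p)), ?_, ?_⟩
  · exact ENNReal.mul_ne_top (ENNReal.mul_ne_top (two_ne_top p hp) (by simp)) (by simp)
  intro f hf e1 e2 e3 h1 h1' h2 h2' h3 h3'
  have A : ∀ t ∈ Ioi (0:ℝ), ∫⁻ x in oct,
        gp p (f (x + (t * e1, t * e2, t * e3))) (f x) * pk (1 + s * p) t ≤
        2 ^ (p - 1) * 2 * ∫⁻ x in oct, loc p f t x * pk (4 + s * p) t := by
    intro t ht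
    have ht : 0 < t := ht
    have hm := loc_meas' p f hf t
    have hpk : pk (1 + s * p) t = ENNReal.ofReal (t ^ 3) * pk (4 + s * p) t := by
      rw [pk, pk, ← ENNReal.ofReal_mul (by positivity)]
      congr 1
      rw [show 4 + s * p = 3 + (1 + s * p) by ring, Real.rpow_add ht 3, mul_inv, ← mul_assoc,
        show t ^ (3:ℝ) = t ^ 3 by norm_cast, mul_inv_cancel₀ (by positivity), one_mul]
    calc _ ≤ ∫⁻ x in oct, (2 ^ (p - 1) * pk (4 + s * p) t) *
          (loc p f t (x + (t * e1, t * e2, t * e3)) + loc p f t x) := by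
          refine setLIntegral_mono' oct_meas fun x hx => ?_
          rw [hpk, ← mul_assoc]
          calc _ ≤ _ := mul_le_mul_left
                (step_avg p hp f hf e1 e2 e3 h1 h1' h2 h2' h3 h3' t ht x hx) _
            _ = _ := by ring
      _ = (2 ^ (p - 1) * pk (4 + s * p) t) *
          ((∫⁻ x in oct, loc p f t (x + (t * e1, t * e2, t * e3))) + ∫⁻ x in oct, loc p f t x) := by
          rw [lintegral_const_mul _ (by fun_prop), lintegral_add_left (by fun_prop)]
      _ ≤ (2 ^ (p - 1) * pk (4 + s * p) t) *
          ((∫⁻ x in oct, loc p f t x) + ∫⁻ x in oct, loc p f t x) := by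
          have hsh := shift_oct (loc p f t) (t * e1, t * e2, t * e3) (mul_nonneg ht.le h1)
            (mul_nonneg ht.le h2) (mul_nonneg ht.le h3)
          exact mul_le_mul_right (add_le_add_left hsh _) _
      _ = _ := by
          rw [lintegral_mul_const _ hm]; ring
  calc _ ≤ ∫⁻ t in Ioi (0:ℝ), ∫⁻ x in oct,
        gp p (f (x + (t * e1, t * e2, t * e3))) (f x) * pk (1 + s * p) t :=
        lintegral_mono_set Ioo_subset_Ioi_self
    _ ≤ ∫⁻ t in Ioi (0:ℝ), 2 ^ (p - 1) * 2 * ∫⁻ x in oct, loc p f t x * pk (4 + s * p) t :=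
        setLIntegral_mono' measurableSet_Ioi A
    _ = 2 ^ (p - 1) * 2 * ∫⁻ t in Ioi (0:ℝ), ∫⁻ x in oct, loc p f t x * pk (4 + s * p) t := by
        rw [lintegral_const_mul _ (by fun_prop)]
    _ = 2 ^ (p - 1) * 2 * ∫⁻ t in Ioi (0:ℝ), ∫⁻ x in oct, ∫⁻ y in oct,
        gp p (f x) (f y) * (if dd x y < 3 * t ^ 2 then 1 else 0) * pk (4 + s * p) t := by
        congr 1
        refine lintegral_congr fun t => lintegral_congr fun x => ?_
        rw [lintegral_mul_const _ (by fun_prop)]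
        rfl
    _ = 2 ^ (p - 1) * 2 * ∫⁻ x in oct, ∫⁻ y in oct, ∫⁻ t in Ioi (0:ℝ),
        gp p (f x) (f y) * (if dd x y < 3 * t ^ 2 then 1 else 0) * pk (4 + s * p) t := by
        congr 1
        rw [lintegral_lintegral_swap (by unfold Function.uncurry; fun_prop)]
        refine lintegral_congr fun x => ?_
        rw [lintegral_lintegral_swap (by unfold Function.uncurry; fun_prop)]
    _ ≤ 2 ^ (p - 1) * 2 * ∫⁻ x in oct, ∫⁻ y in oct,
        ENNReal.ofReal (3 ^ ((s * p + 3) / 2) / (3 + s * p)) *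
        (gp p (f x) (f y) * pk ((s * p + 3) / 2) (dd x y)) := by
        gcongr with x y
        exact inner_t p s hp hs0 f x y
    _ = _ := by
        rw [mul_assoc (2 ^ (p - 1) * 2)]
        congr 1
        rw [gag, ← lintegral_const_mul _ (by fun_prop)]
        refine lintegral_congr fun x => ?_
        rw [lintegral_const_mul _ (by fun_prop)]

lemma lint_oct' (F : ℝ × ℝ × ℝ → ℝ≥0∞) (hF : Measurable F) :
    ∫⁻ x in oct, F x = ∫⁻ a in Ioi (0:ℝ), ∫⁻ u in (Ioi (0:ℝ) ×ˢ Ioi (0:ℝ)), F (a, u) := by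
  rw [oct_eq, Measure.volume_eq_prod, ← Measure.prod_restrict, lintegral_prod _ hF.aemeasurable]

lemma lint_quad (F : ℝ × ℝ → ℝ≥0∞) (hF : Measurable F) :
    ∫⁻ u in (Ioi (0:ℝ) ×ˢ Ioi (0:ℝ)), F u =
      ∫⁻ b in Ioi (0:ℝ), ∫⁻ c in Ioi (0:ℝ), F (b, c) := by
  rw [Measure.volume_eq_prod, ← Measure.prod_restrict, lintegral_prod _ hF.aemeasurable]

lemma lint_oct (F : ℝ × ℝ × ℝ → ℝ≥0∞) (hF : Measurable F) :
    ∫⁻ x in oct, F x =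
      ∫⁻ a in Ioi (0:ℝ), ∫⁻ b in Ioi (0:ℝ), ∫⁻ c in Ioi (0:ℝ), F (a, b, c) := by
  rw [lint_oct' F hF]
  refine lintegral_congr fun a => ?_
  rw [lint_quad _ (by fun_prop)]

def s12 (x : ℝ × ℝ × ℝ) : ℝ × ℝ × ℝ := (x.2.1, x.1, x.2.2)
def s13 (x : ℝ × ℝ × ℝ) : ℝ × ℝ × ℝ := (x.2.2, x.2.1, x.1)

@[fun_prop]
lemma s12_meas : Measurable s12 := by unfold s12; fun_prop
@[fun_prop]
lemma s13_meas : Measurable s13 := by unfold s13; fun_prop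

lemma lint_s12 (F : ℝ × ℝ × ℝ → ℝ≥0∞) (hF : Measurable F) :
    ∫⁻ x in oct, F (s12 x) = ∫⁻ x in oct, F x := by
  rw [lint_oct _ (by fun_prop), lint_oct _ hF,
    lintegral_lintegral_swap (by unfold Function.uncurry; fun_prop)]
  rfl

lemma lint_s13 (F : ℝ × ℝ × ℝ → ℝ≥0∞) (hF : Measurable F) :
    ∫⁻ x in oct, F (s13 x) = ∫⁻ x in oct, F x := by
  rw [lint_oct _ (by fun_prop), lint_oct _ hF]
  simp only [s13]
  -- a b c, F (c,b,a)
  rw [lintegral_lintegral_swap (by unfold Function.uncurry; fun_prop)]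
  -- b a c
  calc _ = ∫⁻ b in Ioi (0:ℝ), ∫⁻ c in Ioi (0:ℝ), ∫⁻ a in Ioi (0:ℝ), F (c, b, a) := by
        refine lintegral_congr fun b => ?_
        rw [lintegral_lintegral_swap (by unfold Function.uncurry; fun_prop)]
    _ = _ := lintegral_lintegral_swap (by unfold Function.uncurry; fun_prop)

lemma lint_swap1 (F : (ℝ × ℝ × ℝ) → (ℝ × ℝ × ℝ) → ℝ≥0∞)
    (hF : Measurable (fun z : (ℝ × ℝ × ℝ) × (ℝ × ℝ × ℝ) => F z.1 z.2)) :
    ∫⁻ x in oct, ∫⁻ y in oct, F (y.1, x.2) (x.1, y.2) = ∫⁻ x in oct, ∫⁻ y in oct, F x y := by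
  have key : ∀ G : (ℝ × ℝ × ℝ) → (ℝ × ℝ × ℝ) → ℝ≥0∞,
      Measurable (fun z : (ℝ × ℝ × ℝ) × (ℝ × ℝ × ℝ) => G z.1 z.2) →
      ∫⁻ x in oct, ∫⁻ y in oct, G x y = ∫⁻ a in Ioi (0:ℝ), ∫⁻ b in Ioi (0:ℝ),
        ∫⁻ u in (Ioi (0:ℝ) ×ˢ Ioi (0:ℝ)), ∫⁻ v in (Ioi (0:ℝ) ×ˢ Ioi (0:ℝ)), G (a, u) (b, v) := by
    intro G hG
    rw [lint_oct' _ (by fun_prop)]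
    refine lintegral_congr fun a => ?_
    rw [lintegral_lintegral_swap (by unfold Function.uncurry; fun_prop)]
    rw [lintegral_lintegral_swap (by unfold Function.uncurry; fun_prop)]
    calc _ = ∫⁻ u in (Ioi (0:ℝ) ×ˢ Ioi (0:ℝ)), ∫⁻ b in Ioi (0:ℝ),
          ∫⁻ v in (Ioi (0:ℝ) ×ˢ Ioi (0:ℝ)), G (a, u) (b, v) := by
          refine lintegral_congr fun u => ?_
          rw [lint_oct' _ (by fun_prop)]
      _ = _ := lintegral_lintegral_swap (by unfold Function.uncurry; fun_prop)
  rw [key F hF, key (fun x y => F (y.1, x.2) (x.1, y.2)) (by fun_prop)]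
  rw [lintegral_lintegral_swap (by unfold Function.uncurry; fun_prop)]

noncomputable def JJ (p s : ℝ) (f : ℝ × ℝ × ℝ → ℝ) : ℝ≥0∞ :=
  ∫⁻ x in oct, ∫⁻ y in oct, gp p (f x) (f (y.1, x.2)) * pk ((s * p + 3) / 2) (dd x y)

noncomputable def EE (p s : ℝ) (f : ℝ × ℝ × ℝ → ℝ) : ℝ≥0∞ :=
  ∫⁻ t in Ioo (0:ℝ) 1, ∫⁻ x in oct, gp p (f (x.1 + t, x.2)) (f x) * pk (1 + s * p) t

noncomputable def NN (p : ℝ) (f : ℝ × ℝ × ℝ → ℝ) : ℝ≥0∞ :=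
  ∫⁻ x in oct, gp p (f x) 0

lemma gag_le (p s : ℝ) (hp : 1 < p) (f : ℝ × ℝ × ℝ → ℝ) (hf : Measurable f) :
    gag p s f ≤ 2 ^ (p - 1) * (JJ p s f + 2 ^ (p - 1) *
      (JJ p s (fun x => f (s12 x)) + JJ p s (fun x => f (s13 x)))) := by
  have T2 : ∫⁻ x in oct, ∫⁻ y in oct, gp p (f (y.1, x.2)) (f (y.1, y.2.1, x.2.2)) *
      pk ((s * p + 3) / 2) (dd x y) = JJ p s (fun x => f (s12 x)) := by
    calc _ = ∫⁻ x in oct, ∫⁻ y in oct, gp p (f x) (f (x.1, y.2.1, x.2.2)) *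
          pk ((s * p + 3) / 2) (dd x y) := by
          rw [← lint_swap1 _ (by fun_prop)]
          refine lintegral_congr fun x => lintegral_congr fun y => ?_
          have : dd (y.1, x.2) (x.1, y.2) = dd x y := by simp only [dd]; ring
          rw [this]
      _ = _ := by
          rw [← lint_s12 _ (by fun_prop)]
          refine lintegral_congr fun x => ?_
          rw [← lint_s12 _ (by fun_prop)]
          refine lintegral_congr fun y => ?_
          have : dd (s12 x) (s12 y) = dd x y := by simp only [dd, s12]; ring
          rw [this]; rfl
  have T3 : ∫⁻ x in oct, ∫⁻ y in oct, gp p (f (y.1, y.2.1, x.2.2)) (f y) *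
      pk ((s * p + 3) / 2) (dd x y) = JJ p s (fun x => f (s13 x)) := by
    rw [lintegral_lintegral_swap (by unfold Function.uncurry; fun_prop)]
    rw [← lint_s13 _ (by fun_prop)]
    refine lintegral_congr fun x => ?_
    rw [← lint_s13 _ (by fun_prop)]
    refine lintegral_congr fun y => ?_
    have : dd (s13 y) (s13 x) = dd x y := by simp only [dd, s13]; ring
    rw [this, gp_comm]; rfl
  calc gag p s f ≤ ∫⁻ x in oct, ∫⁻ y in oct, 2 ^ (p - 1) *
        (gp p (f x) (f (y.1, x.2)) * pk ((s * p + 3) / 2) (dd x y) + 2 ^ (p - 1) *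
          (gp p (f (y.1, x.2)) (f (y.1, y.2.1, x.2.2)) * pk ((s * p + 3) / 2) (dd x y) +
            gp p (f (y.1, y.2.1, x.2.2)) (f y) * pk ((s * p + 3) / 2) (dd x y))) := by
        unfold gag
        refine lintegral_mono fun x => lintegral_mono fun y => ?_
        have h1 := gp_tri p hp (f x) (f (y.1, x.2)) (f y)
        have h2 := gp_tri p hp (f (y.1, x.2)) (f (y.1, y.2.1, x.2.2)) (f y)
        have h3 := h1.trans (mul_le_mul_right (add_le_add_right h2 _) _)
        calc _ ≤ _ := mul_le_mul_left h3 _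
          _ = _ := by ring
    _ = ∫⁻ x in oct, 2 ^ (p - 1) * ((∫⁻ y in oct,
        gp p (f x) (f (y.1, x.2)) * pk ((s * p + 3) / 2) (dd x y)) + 2 ^ (p - 1) * ((∫⁻ y in oct,
          gp p (f (y.1, x.2)) (f (y.1, y.2.1, x.2.2)) * pk ((s * p + 3) / 2) (dd x y)) +
            ∫⁻ y in oct,
            gp p (f (y.1, y.2.1, x.2.2)) (f y) * pk ((s * p + 3) / 2) (dd x y))) := by
        refine lintegral_congr fun x => ?_
        rw [lintegral_const_mul _ (by fun_prop), lintegral_add_left (by fun_prop),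
          lintegral_const_mul _ (by fun_prop), lintegral_add_left (by fun_prop)]
    _ = _ := by
        rw [lintegral_const_mul _ (by fun_prop), lintegral_add_left (by fun_prop),
          lintegral_const_mul _ (by fun_prop), lintegral_add_left (by fun_prop), T2, T3]
        rfl

lemma sym1d (Φ : ℝ → ℝ → ℝ≥0∞) (hΦ : Measurable (fun z : ℝ × ℝ => Φ z.1 z.2))
    (hs : ∀ a b, Φ a b = Φ b a) (h0 : ∀ a, Φ a a = 0) :
    ∫⁻ a in Ioi (0:ℝ), ∫⁻ b in Ioi (0:ℝ), Φ a b ≤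
      2 * ∫⁻ t in Ioi (0:ℝ), ∫⁻ a in Ioi (0:ℝ), Φ (a + t) a := by
  set Ψ : ℝ → ℝ → ℝ≥0∞ := fun a b => if b < a then Φ a b else 0 with hΨ
  have hΨm : Measurable (fun z : ℝ × ℝ => Ψ z.1 z.2) :=
    Measurable.ite (measurableSet_lt measurable_snd measurable_fst) hΦ measurable_const
  have hsw : ∫⁻ a in Ioi (0:ℝ), ∫⁻ b in Ioi (0:ℝ), Ψ b a =
      ∫⁻ a in Ioi (0:ℝ), ∫⁻ b in Ioi (0:ℝ), Ψ a b :=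
    lintegral_lintegral_swap (by unfold Function.uncurry; fun_prop)
  calc _ ≤ ∫⁻ a in Ioi (0:ℝ), ∫⁻ b in Ioi (0:ℝ), (Ψ a b + Ψ b a) := by
        refine lintegral_mono fun a => lintegral_mono fun b => ?_
        simp only [hΨ]
        rcases lt_trichotomy a b with h | h | h
        · simp [h, h.not_gt, hs a b]
        · subst h; simp [h0]
        · simp [h, h.not_gt]
    _ = ∫⁻ a in Ioi (0:ℝ), ((∫⁻ b in Ioi (0:ℝ), Ψ a b) + ∫⁻ b in Ioi (0:ℝ), Ψ b a) := by
        refine lintegral_congr fun a => ?_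
        rw [lintegral_add_left (by fun_prop)]
    _ = 2 * ∫⁻ a in Ioi (0:ℝ), ∫⁻ b in Ioi (0:ℝ), Ψ b a := by
        rw [lintegral_add_left (by fun_prop), hsw, two_mul]
    _ ≤ 2 * ∫⁻ a in Ioi (0:ℝ), ∫⁻ t in Ioi (0:ℝ), Φ (a + t) a := by
        refine mul_le_mul_right (lintegral_mono fun a => ?_) _
        calc _ ≤ ∫⁻ b, Ψ b a := setLIntegral_le_lintegral _ _
          _ = ∫⁻ t, Ψ (t + a) a := (lintegral_add_right_eq_self (fun b => Ψ b a) a).symm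
          _ = ∫⁻ t, (Ioi (0:ℝ)).indicator (fun t => Φ (a + t) a) t := by
              refine lintegral_congr fun t => ?_
              simp [hΨ, indicator, add_comm]
          _ = _ := lintegral_indicator measurableSet_Ioi _
    _ = _ := by
        rw [lintegral_lintegral_swap (by unfold Function.uncurry; fun_prop)]

noncomputable def SS (α a : ℝ) : ℝ≥0∞ := ∫⁻ u : ℝ, pk α (a ^ 2 + u ^ 2)

lemma SS_one (α : ℝ) (hα : 1 < 2 * α) : SS α 1 ≠ ⊤ := by
  have h := integrable_rpow_neg_one_add_norm_sq (E := ℝ) (μ := volume) (r := 2 * α) (by simpa using hα)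
  have h2 := h.lintegral_lt_top
  refine ne_of_lt (lt_of_le_of_lt (lintegral_mono fun u => ?_) h2)
  rw [pk]
  apply ENNReal.ofReal_le_ofReal
  rw [show -(2 * α) / 2 = -α by ring, Real.rpow_neg (by positivity)]
  simp

lemma SS_scale (α a : ℝ) (ha : a ≠ 0) : SS α a = ENNReal.ofReal (|a| ^ (1 - 2 * α)) * SS α 1 := by
  have h1 : ∫⁻ u : ℝ, pk α (a ^ 2 + (a * u) ^ 2) = ENNReal.ofReal |a⁻¹| * SS α a := by
    rw [SS, ← smul_eq_mul, ← lintegral_smul_measure, ← Real.map_volume_mul_left ha,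
      lintegral_map (by fun_prop) (by fun_prop)]
  have h2 : ∫⁻ u : ℝ, pk α (a ^ 2 + (a * u) ^ 2) = ENNReal.ofReal (|a| ^ (- 2 * α)) * SS α 1 := by
    rw [SS, ← lintegral_const_mul _ (by fun_prop)]
    refine lintegral_congr fun u => ?_
    rw [pk, pk, ← ENNReal.ofReal_mul (by positivity)]
    congr 1
    rw [show a ^ 2 + (a * u) ^ 2 = |a| ^ 2 * (1 ^ 2 + u ^ 2) by rw [sq_abs]; ring,
      Real.mul_rpow (by positivity) (by positivity), mul_inv, ← Real.rpow_natCast,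
      ← Real.rpow_mul (abs_nonneg a), ← Real.rpow_neg (abs_nonneg a)]
    simp
  have ha' : 0 < |a| := abs_pos.2 ha
  have h3 : ENNReal.ofReal |a| * ENNReal.ofReal |a⁻¹| = 1 := by
    rw [← ENNReal.ofReal_mul ha'.le, abs_inv, mul_inv_cancel₀ ha'.ne', ENNReal.ofReal_one]
  calc SS α a = ENNReal.ofReal |a| * (ENNReal.ofReal |a⁻¹| * SS α a) := by
        rw [← mul_assoc, h3, one_mul]
    _ = _ := by
        rw [← h1, h2, ← mul_assoc, ← ENNReal.ofReal_mul ha'.le]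
        congr 2
        rw [show 1 - 2 * α = 1 + (-2 * α) by ring, Real.rpow_add ha', Real.rpow_one]

lemma inner_y (p s : ℝ) (hp : 1 < p) (hs0 : 0 < s) (f : ℝ × ℝ × ℝ → ℝ) (hf : Measurable f)
    (x : ℝ × ℝ × ℝ) :
    ∫⁻ y in oct, gp p (f x) (f (y.1, x.2)) * pk ((s * p + 3) / 2) (dd x y) ≤
    SS ((s * p + 3) / 4) 1 ^ 2 *
      ∫⁻ a in Ioi (0:ℝ), gp p (f x) (f (a, x.2)) * pk (1 + s * p) |x.1 - a| := by
  have hsp : 0 < s * p := by positivity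
  set α := (s * p + 3) / 4 with hα
  rw [lint_oct _ (by fun_prop), ← lintegral_const_mul _ (by
    have : Measurable (fun a : ℝ => |x.1 - a|) := by
      simpa [Real.norm_eq_abs] using (measurable_const.sub measurable_id : Measurable (fun a : ℝ => x.1 - a)).norm
    fun_prop)]
  refine lintegral_mono fun a => ?_
  by_cases ha : x.1 = a
  · have : (a, x.2) = x := by rw [← ha]
    simp [this, gp_self p hp]
  have ha : x.1 - a ≠ 0 := sub_ne_zero.2 ha
  have hpos : ∀ u : ℝ, 0 < (x.1 - a) ^ 2 + u ^ 2 := fun u => by positivity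
  have shift : ∀ z : ℝ, ∫⁻ b in Ioi (0:ℝ), pk α ((x.1 - a) ^ 2 + (z - b) ^ 2) ≤ SS α (x.1 - a) := by
    intro z
    refine (setLIntegral_le_lintegral _ _).trans ?_
    exact (lintegral_sub_left_eq_self (fun u => pk α ((x.1 - a) ^ 2 + u ^ 2)) z).le
  have hk : ∀ b c : ℝ, pk ((s * p + 3) / 2) (dd x (a, b, c)) ≤
      pk α ((x.1 - a) ^ 2 + (x.2.1 - b) ^ 2) * pk α ((x.1 - a) ^ 2 + (x.2.2 - c) ^ 2) := by
    intro b c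
    rw [pk, pk, pk, ← ENNReal.ofReal_mul (by positivity)]
    apply ENNReal.ofReal_le_ofReal
    have hA := hpos (x.2.1 - b)
    have hB := hpos (x.2.2 - c)
    have hd : 0 < dd x (a, b, c) := by
      simp only [dd]; positivity
    rw [← mul_inv, show (s * p + 3) / 2 = α + α by rw [hα]; ring, Real.rpow_add hd]
    have hα0 : 0 ≤ α := by positivity
    gcongr
    · simp only [dd]; nlinarith [sq_nonneg (x.2.2 - c)]
    · simp only [dd]; nlinarith [sq_nonneg (x.2.1 - b)]
  calc _ ≤ ∫⁻ b in Ioi (0:ℝ), ∫⁻ c in Ioi (0:ℝ), gp p (f x) (f (a, x.2)) *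
        (pk α ((x.1 - a) ^ 2 + (x.2.1 - b) ^ 2) * pk α ((x.1 - a) ^ 2 + (x.2.2 - c) ^ 2)) := by
        refine lintegral_mono fun b => lintegral_mono fun c => ?_
        exact mul_le_mul_right (hk b c) _
    _ = gp p (f x) (f (a, x.2)) * ((∫⁻ b in Ioi (0:ℝ), pk α ((x.1 - a) ^ 2 + (x.2.1 - b) ^ 2)) *
        ∫⁻ c in Ioi (0:ℝ), pk α ((x.1 - a) ^ 2 + (x.2.2 - c) ^ 2)) := by
        rw [← lintegral_mul_const _ (by fun_prop), ← lintegral_const_mul _ (by fun_prop)]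
        refine lintegral_congr fun b => ?_
        rw [lintegral_const_mul _ (by fun_prop), lintegral_const_mul _ (by fun_prop)]
    _ ≤ gp p (f x) (f (a, x.2)) * (SS α (x.1 - a) * SS α (x.1 - a)) := by
        gcongr
        · exact shift _
        · exact shift _
    _ = _ := by
        rw [SS_scale α _ ha]
        have : pk (1 + s * p) |x.1 - a| = ENNReal.ofReal (|x.1 - a| ^ (1 - 2 * α)) *
            ENNReal.ofReal (|x.1 - a| ^ (1 - 2 * α)) := by
          rw [pk, ← ENNReal.ofReal_mul (by positivity), ← Real.rpow_add (abs_pos.2 ha),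
            ← Real.rpow_neg (abs_nonneg _)]
          congr 2; rw [hα]; ring
        rw [this]; ring

lemma abs_meas' {β : Type*} [MeasurableSpace β] {u : β → ℝ} (hu : Measurable u) :
    Measurable (fun z => |u z|) := by
  simpa [Real.norm_eq_abs] using hu.norm

lemma tail_bd (p s : ℝ) (hp : 1 < p) (f : ℝ × ℝ × ℝ → ℝ) (hf : Measurable f) (t : ℝ)
    (ht : 0 ≤ t) :
    ∫⁻ x in oct, gp p (f (x.1 + t, x.2)) (f x) * pk (1 + s * p) t ≤
      2 ^ (p - 1) * 2 * NN p f * pk (1 + s * p) t := by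
  rw [lintegral_mul_const _ (by fun_prop)]
  gcongr
  calc _ ≤ ∫⁻ x in oct, 2 ^ (p - 1) * (gp p (f (x + (t, 0, 0))) 0 + gp p (f x) 0) := by
        refine lintegral_mono fun x => ?_
        have h := gp_tri p hp (f (x.1 + t, x.2)) 0 (f x)
        rw [gp_comm p 0] at h
        have e : x + (t, 0, 0) = (x.1 + t, x.2) := by ext <;> simp
        simp only [e]; exact h
    _ = 2 ^ (p - 1) * ((∫⁻ x in oct, gp p (f (x + (t, 0, 0))) 0) + NN p f) := by
        rw [lintegral_const_mul _ (by fun_prop), lintegral_add_left (by fun_prop)]; rfl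
    _ ≤ 2 ^ (p - 1) * (NN p f + NN p f) := by
        have := shift_oct (fun x => gp p (f x) 0) (t, 0, 0) ht le_rfl le_rfl
        exact mul_le_mul_right (add_le_add_left this _) _
    _ = _ := by ring

lemma tailpart (p s : ℝ) (hp : 1 < p) (hs0 : 0 < s) :
    ∃ L : ℝ≥0∞, L ≠ ⊤ ∧ ∀ f : ℝ × ℝ × ℝ → ℝ, Measurable f →
    ∫⁻ t in Ioi (0:ℝ), ∫⁻ x in oct,
      gp p (f (x.1 + t, x.2)) (f x) * pk (1 + s * p) t ≤ EE p s f + L * NN p f := by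
  have hsp : 0 < s * p := by positivity
  refine ⟨2 ^ (p - 1) * 2 * ENNReal.ofReal (1 ^ (1 - (1 + s * p)) / (1 + s * p - 1)),
    ENNReal.mul_ne_top (ENNReal.mul_ne_top (two_ne_top p hp) (by simp)) (by simp), ?_⟩
  intro f hf
  rw [← Ioc_union_Ioi_eq_Ioi (zero_le_one (α := ℝ))]
  refine (lintegral_union_le _ _ _).trans ?_
  rw [setLIntegral_congr (Ioo_ae_eq_Ioc (μ := volume) (a := (0:ℝ)) (b := 1)).symm]
  refine add_le_add_right ?_ _
  calc _ ≤ ∫⁻ t in Ioi (1:ℝ), 2 ^ (p - 1) * 2 * NN p f * pk (1 + s * p) t :=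
        setLIntegral_mono' measurableSet_Ioi fun t ht =>
          tail_bd p s hp f hf t (zero_le_one.trans (le_of_lt ht))
    _ = _ := by
        rw [lintegral_const_mul _ (by fun_prop), tail_int _ _ (by linarith) one_pos]
        exact mul_right_comm _ _ _

lemma one_dir (p s : ℝ) (hp : 1 < p) (f : ℝ × ℝ × ℝ → ℝ) (hf : Measurable f) :
    ∫⁻ x in oct, ∫⁻ a in Ioi (0:ℝ), gp p (f x) (f (a, x.2)) * pk (1 + s * p) |x.1 - a| ≤
    2 * ∫⁻ t in Ioi (0:ℝ), ∫⁻ x in oct,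
          gp p (f (x.1 + t, x.2)) (f x) * pk (1 + s * p) t := by
  have hab : Measurable (fun z : (ℝ × ℝ × ℝ) × ℝ => |z.1.1 - z.2|) := abs_meas' (by fun_prop)
  have hab3 : Measurable (fun z : ℝ × ℝ => |z.1 - z.2|) := abs_meas' (by fun_prop)
  have m1 : Measurable (fun z : (ℝ × ℝ × ℝ) × ℝ =>
      gp p (f z.1) (f (z.2, z.1.2)) * pk (1 + s * p) |z.1.1 - z.2|) := by fun_prop
  have m1' : Measurable (fun x : (ℝ × ℝ × ℝ) => ∫⁻ a in Ioi (0:ℝ),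
      gp p (f x) (f (a, x.2)) * pk (1 + s * p) |x.1 - a|) := Measurable.lintegral_prod_right m1
  calc _ = ∫⁻ u in (Ioi (0:ℝ) ×ˢ Ioi (0:ℝ)), ∫⁻ b in Ioi (0:ℝ), ∫⁻ a in Ioi (0:ℝ),
          gp p (f (b, u)) (f (a, u)) * pk (1 + s * p) |b - a| := by
        rw [lint_oct' _ m1']
        exact lintegral_lintegral_swap (f := fun (b : ℝ) (u : ℝ × ℝ) => ∫⁻ a in Ioi (0:ℝ),
          gp p (f (b, u)) (f (a, u)) * pk (1 + s * p) |b - a|) m1'.aemeasurable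
    _ ≤ ∫⁻ u in (Ioi (0:ℝ) ×ˢ Ioi (0:ℝ)), 2 * ∫⁻ t in Ioi (0:ℝ), ∫⁻ a in Ioi (0:ℝ),
          gp p (f (a + t, u)) (f (a, u)) * pk (1 + s * p) |a + t - a| := by
        refine lintegral_mono fun u => ?_
        refine sym1d (fun b a => gp p (f (b, u)) (f (a, u)) * pk (1 + s * p) |b - a|) ?_ ?_ ?_
        · fun_prop
        · intro a b; rw [gp_comm, abs_sub_comm]
        · intro a; rw [gp_self p hp, zero_mul]
    _ = ∫⁻ u in (Ioi (0:ℝ) ×ˢ Ioi (0:ℝ)), 2 * ∫⁻ t in Ioi (0:ℝ), ∫⁻ a in Ioi (0:ℝ),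
          gp p (f (a + t, u)) (f (a, u)) * pk (1 + s * p) t := by
        refine lintegral_congr fun u => ?_
        congr 1
        refine setLIntegral_congr_fun measurableSet_Ioi fun t ht => ?_
        have ht : 0 < t := ht
        simp only [add_sub_cancel_left, abs_of_pos ht]
    _ = _ := by
        rw [lintegral_const_mul _ (by fun_prop)]
        congr 1
        rw [lintegral_lintegral_swap (by unfold Function.uncurry; fun_prop)]
        refine lintegral_congr fun t => ?_
        rw [lint_oct' _ (by fun_prop),
          lintegral_lintegral_swap (by unfold Function.uncurry; fun_prop)]

lemma JJ_le (p s : ℝ) (hp : 1 < p) (hs0 : 0 < s) :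
    ∃ C : ℝ≥0∞, C ≠ ⊤ ∧ ∀ f : ℝ × ℝ × ℝ → ℝ, Measurable f →
      JJ p s f ≤ C * (NN p f + EE p s f) := by
  have hsp : 0 < s * p := by positivity
  have hKt : SS ((s * p + 3) / 4) 1 ^ 2 ≠ ⊤ := ENNReal.pow_ne_top (SS_one _ (by linarith))
  obtain ⟨L, hLt, hL⟩ := tailpart p s hp hs0
  have hin := inner_y p s hp hs0
  generalize SS ((s * p + 3) / 4) 1 ^ 2 = K at hKt hin
  refine ⟨K * 2 * (1 + L), ENNReal.mul_ne_top (ENNReal.mul_ne_top hKt (by simp))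
    (ENNReal.add_ne_top.2 ⟨by simp, hLt⟩), ?_⟩
  intro f hf
  have h1 : JJ p s f ≤ K * ∫⁻ x in oct, ∫⁻ a in Ioi (0:ℝ),
      gp p (f x) (f (a, x.2)) * pk (1 + s * p) |x.1 - a| := by
    rw [← lintegral_const_mul' _ _ hKt]
    exact lintegral_mono fun x => hin f hf x
  refine h1.trans ?_
  refine (mul_le_mul_right ((one_dir p s hp f hf).trans (mul_le_mul_right (hL f hf) _)) _).trans ?_
  calc K * (2 * (EE p s f + L * NN p f)) ≤
        K * (2 * ((EE p s f + L * NN p f) + (NN p f + L * EE p s f))) := by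
        exact mul_le_mul_right (mul_le_mul_right le_self_add _) _
    _ = _ := by ring

lemma trunc_eq (p s : ℝ) (f : ℝ × ℝ × ℝ → ℝ) (hf : Measurable f) :
    truncNorm p s f = NN p f + (EE p s f + EE p s (fun x => f (s12 x)) +
      EE p s (fun x => f (s13 x))) := by
  unfold truncNorm
  congr 1
  · simp only [NN, gp, sub_zero]
  congr 1
  · congr 1
    · simp only [ofReal_div']; rfl
    · simp only [ofReal_div', EE]
      refine lintegral_congr fun t => ?_
      rw [← lint_s12 _ (by fun_prop)]
      rfl
  · simp only [ofReal_div', EE]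
    refine lintegral_congr fun t => ?_
    rw [← lint_s13 _ (by fun_prop)]
    rfl

lemma full_eq (p s : ℝ) (f : ℝ × ℝ × ℝ → ℝ) : fullNorm p s f = NN p f + gag p s f := by
  unfold fullNorm
  congr 1
  · simp only [NN, gp, sub_zero]
  · simp only [ofReal_div']; rfl

lemma trunc_le (p s : ℝ) (hp : 1 < p) (hs0 : 0 < s) :
    ∃ C : ℝ≥0∞, C ≠ ⊤ ∧ ∀ f : ℝ × ℝ × ℝ → ℝ, Measurable f →
      truncNorm p s f ≤ C * fullNorm p s f := by
  obtain ⟨C, hC, h⟩ := dir2 p s hp hs0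
  refine ⟨1 + 3 * C, ENNReal.add_ne_top.2 ⟨by simp, ENNReal.mul_ne_top (by simp) hC⟩, ?_⟩
  intro f hf
  have h1 := h f hf 1 0 0 (by norm_num) (by norm_num) (by norm_num) (by norm_num) (by norm_num)
    (by norm_num)
  have h2 := h f hf 0 1 0 (by norm_num) (by norm_num) (by norm_num) (by norm_num) (by norm_num)
    (by norm_num)
  have h3 := h f hf 0 0 1 (by norm_num) (by norm_num) (by norm_num) (by norm_num) (by norm_num)
    (by norm_num)
  have e1 : ∀ (x : ℝ × ℝ × ℝ) (t : ℝ), x + (t * 1, t * 0, t * 0) = (x.1 + t, x.2.1, x.2.2) := by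
    intro x t; ext <;> simp
  have e2 : ∀ (x : ℝ × ℝ × ℝ) (t : ℝ), x + (t * 0, t * 1, t * 0) = (x.1, x.2.1 + t, x.2.2) := by
    intro x t; ext <;> simp
  have e3 : ∀ (x : ℝ × ℝ × ℝ) (t : ℝ), x + (t * 0, t * 0, t * 1) = (x.1, x.2.1, x.2.2 + t) := by
    intro x t; ext <;> simp
  simp only [e1] at h1
  simp only [e2] at h2
  simp only [e3] at h3
  rw [full_eq]
  unfold truncNorm
  simp only [ofReal_div']
  have h0 : ∫⁻ x in oct, ENNReal.ofReal (|f x| ^ p) = NN p f := by simp only [NN, gp, sub_zero]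
  rw [h0]
  calc _ ≤ NN p f + (C * gag p s f + C * gag p s f + C * gag p s f) :=
        add_le_add_right (add_le_add (add_le_add h1 h2) h3) _
    _ ≤ (NN p f + (C * gag p s f + C * gag p s f + C * gag p s f)) +
        (gag p s f + 3 * C * NN p f) := le_self_add
    _ = _ := by ring

lemma full_le (p s : ℝ) (hp : 1 < p) (hs0 : 0 < s) :
    ∃ C : ℝ≥0∞, C ≠ ⊤ ∧ ∀ f : ℝ × ℝ × ℝ → ℝ, Measurable f →
      fullNorm p s f ≤ C * truncNorm p s f := by
  obtain ⟨C, hC, h⟩ := JJ_le p s hp hs0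
  have hc := two_ne_top p hp
  set c : ℝ≥0∞ := 2 ^ (p - 1) with hcdef
  refine ⟨1 + c * (C + c * (C + C)), ?_, ?_⟩
  · exact ENNReal.add_ne_top.2 ⟨by simp, ENNReal.mul_ne_top hc (ENNReal.add_ne_top.2 ⟨hC,
      ENNReal.mul_ne_top hc (ENNReal.add_ne_top.2 ⟨hC, hC⟩)⟩)⟩
  intro f hf
  have n2 : NN p (fun x => f (s12 x)) = NN p f :=
    lint_s12 (fun x => gp p (f x) 0) (by fun_prop)
  have n3 : NN p (fun x => f (s13 x)) = NN p f :=
    lint_s13 (fun x => gp p (f x) 0) (by fun_prop)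
  have h1 := h f hf
  have h2 := h (fun x => f (s12 x)) (by fun_prop)
  have h3 := h (fun x => f (s13 x)) (by fun_prop)
  rw [n2] at h2
  rw [n3] at h3
  have hg := gag_le p s hp f hf
  have tr := trunc_eq p s f hf
  have b0 : NN p f ≤ truncNorm p s f := by rw [tr]; exact le_self_add
  have b1 : NN p f + EE p s f ≤ truncNorm p s f := by
    rw [tr]; gcongr; rw [add_assoc]; exact le_self_add
  have b2 : NN p f + EE p s (fun x => f (s12 x)) ≤ truncNorm p s f := by
    rw [tr]; gcongr; exact le_add_self.trans le_self_add
  have b3 : NN p f + EE p s (fun x => f (s13 x)) ≤ truncNorm p s f := by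
    rw [tr]; gcongr; exact le_add_self
  have k1 := h1.trans (mul_le_mul_right b1 C)
  have k2 := h2.trans (mul_le_mul_right b2 C)
  have k3 := h3.trans (mul_le_mul_right b3 C)
  rw [full_eq]
  calc _ ≤ truncNorm p s f + c * (C * truncNorm p s f + c *
        (C * truncNorm p s f + C * truncNorm p s f)) :=
        add_le_add b0 (hg.trans (mul_le_mul_right (add_le_add k1
          (mul_le_mul_right (add_le_add k2 k3) _)) _))
    _ = _ := by ring

/-- Equivalence of the full `W^{s,p}` norm on the first octant with the
truncated directional seminorm characterization, for all `f ∈ W^{s,p}(𝒪₁)`: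
there is a constant `C = C(s,p) > 0` with
`fullNorm ≤ C ⋅ truncNorm` and `truncNorm ≤ C ⋅ fullNorm`. -/
theorem stmt18 (p s : ℝ) (hp : 1 < p) (hs0 : 0 < s) (hs1 : s < 1) :
    ∃ C : ℝ, 0 < C ∧ ∀ f : ℝ × ℝ × ℝ → ℝ, Measurable f → fullNorm p s f < ⊤ →
      (fullNorm p s f ≤ ENNReal.ofReal C * truncNorm p s f ∧
        truncNorm p s f ≤ ENNReal.ofReal C * fullNorm p s f) := by
  obtain ⟨C1, hC1, h1⟩ := full_le p s hp hs0
  obtain ⟨C2, hC2, h2⟩ := trunc_le p s hp hs0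
  refine ⟨C1.toReal + C2.toReal + 1, by positivity, fun f hf _ => ⟨?_, ?_⟩⟩
  · refine (h1 f hf).trans (mul_le_mul_left ?_ _)
    rw [← ENNReal.ofReal_toReal hC1]
    apply ENNReal.ofReal_le_ofReal
    rw [ENNReal.toReal_ofReal (by positivity)]
    have : 0 ≤ C2.toReal := ENNReal.toReal_nonneg
    linarith
  · refine (h2 f hf).trans (mul_le_mul_left ?_ _)
    rw [← ENNReal.ofReal_toReal hC2]
    apply ENNReal.ofReal_le_ofReal
    rw [ENNReal.toReal_ofReal (by positivity)]
    have : 0 ≤ C1.toReal := ENNReal.toReal_nonneg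
    linarith
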